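/- Induction relation (equation (10) of the paper). Under the PIR-with-private-side-information setup, with S = {1,…,M}, demand set 𝒫 = {M+1,…,M+P}, and A_1 = A_1^{S,𝒫}, if P ≤ (K−M)/2 then N·H(A_1 | Q, W_S) ≥ (1 + 1/N)·P·L + (1/N)·H(A_1 | W_{M+1},…,W_{M+2P}, Q, W_S). -/

import Mathlib

open scoped BigOperators

/-- Probability that random variable `X` takes the value `x`, under the
probability mass function `p` on the finite sample space `Ω`. -/
noncomputable def pr {Ω : Type} [Fintype Ω] (p : Ω → ℝ) {α : Type} [DecidableEq α]
    (X : Ω → α) (x : α) : ℝ :=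
  ∑ ω ∈ Finset.univ.filter (fun ω => X ω = x), p ω

/-- Shannon entropy of `X` in base `b` (with the convention `0 * log 0 = 0`). -/
noncomputable def ent {Ω : Type} [Fintype Ω] (b : ℝ) (p : Ω → ℝ) {α : Type} [Fintype α]
    [DecidableEq α] (X : Ω → α) : ℝ :=
  -∑ x : α, pr p X x * Real.logb b (pr p X x)

/-- Conditional entropy `H(X ∣ Y) = H(X, Y) - H(Y)`, in base `b`. -/
noncomputable def condEnt {Ω : Type} [Fintype Ω] (b : ℝ) (p : Ω → ℝ) {α β : Type} [Fintype α]
    [DecidableEq α] [Fintype β] [DecidableEq β] (X : Ω → α) (Y : Ω → β) : ℝ :=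
  ent b p (fun ω => (X ω, Y ω)) - ent b p Y

/-- `X` is a deterministic function of `Y`. -/
def detFn {Ω α β : Type} (X : Ω → α) (Y : Ω → β) : Prop :=
  ∃ f : β → α, ∀ ω, X ω = f (Y ω)

/-- Admissible demand sets: subsets of `{1,…,K} \ S` of size `P`
(indices are `0`-based, and `S = {1,…,M}` corresponds to indices `< M`). -/
def demands (K M P : ℕ) : Finset (Finset (Fin K)) :=
  Finset.univ.filter (fun T => T.card = P ∧ ∀ i ∈ T, M ≤ i.val)

lemma detFn.eq_of_eq {Ω α β : Type} {X : Ω → α} {Y : Ω → β} (h : detFn X Y)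
    {ω ω' : Ω} (hY : Y ω = Y ω') : X ω = X ω' := by
  obtain ⟨f, hf⟩ := h
  rw [hf, hf, hY]

section Entropy

variable {Ω : Type} [Fintype Ω] {p : Ω → ℝ} {b : ℝ}
variable {α β γ : Type} [DecidableEq α] [DecidableEq β] [DecidableEq γ]

lemma pr_nonneg (hp : ∀ ω, 0 ≤ p ω) (X : Ω → α) (x : α) : 0 ≤ pr p X x :=
  Finset.sum_nonneg fun ω _ => hp ω

lemma pr_self_pos (hp : ∀ ω, 0 ≤ p ω) (X : Ω → α) {ω : Ω} (hω : 0 < p ω) :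
    0 < pr p X (X ω) :=
  hω.trans_le <| Finset.single_le_sum (f := p) (fun ω _ => hp ω) (by simp)

/-- The law of the unconscious statistician for a finite random variable. -/
lemma sum_pr_mul [Fintype α] (X : Ω → α) (g : α → ℝ) :
    ∑ x, pr p X x * g x = ∑ ω, p ω * g (X ω) := by
  rw [← Finset.sum_fiberwise Finset.univ X fun ω => p ω * g (X ω)]
  refine Finset.sum_congr rfl fun x _ => ?_
  rw [pr, Finset.sum_mul]
  refine Finset.sum_congr rfl fun ω hω => ?_
  rw [(Finset.mem_filter.1 hω).2]

lemma pr_comp [Fintype α] (X : Ω → α) (f : α → β) (y : β) :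
    pr p (fun ω => f (X ω)) y = ∑ x with f x = y, pr p X x := by
  have h := sum_pr_mul (p := p) X fun x => if f x = y then 1 else 0
  simpa [pr, Finset.sum_filter] using h.symm

lemma sum_pr_prod_left [Fintype α] [Fintype β] (X : Ω → α) (Y : Ω → β) (y : β) :
    ∑ x, pr p (fun ω => (X ω, Y ω)) (x, y) = pr p Y y := by
  have h := pr_comp (p := p) (fun ω => (X ω, Y ω)) Prod.snd y
  rw [h, Finset.sum_filter, Fintype.sum_prod_type]
  simp

lemma ent_eq_sum [Fintype α] (X : Ω → α) :
    ent b p X = -∑ ω, p ω * Real.logb b (pr p X (X ω)) := by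
  rw [ent, sum_pr_mul X fun x => Real.logb b (pr p X x)]

lemma ent_congr [Fintype α] [Fintype β] {X : Ω → α} {Y : Ω → β}
    (h : ∀ ω ω', X ω = X ω' ↔ Y ω = Y ω') : ent b p X = ent b p Y := by
  simp only [ent_eq_sum, pr, h]

lemma condEnt_congr_right [Fintype α] [Fintype β] [Fintype γ] (X : Ω → α) {Y : Ω → β}
    {Z : Ω → γ} (h : ∀ ω ω', Y ω = Y ω' ↔ Z ω = Z ω') : condEnt b p X Y = condEnt b p X Z := by
  rw [condEnt, condEnt, ent_congr h, sub_left_inj]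
  refine ent_congr fun ω ω' => ?_
  rw [Prod.mk.injEq, Prod.mk.injEq, h]

lemma ent_mono [Fintype α] [Fintype β] (hb : 1 < b) (hp : ∀ ω, 0 ≤ p ω) {X : Ω → α} {Y : Ω → β}
    (h : ∀ ω ω', Y ω = Y ω' → X ω = X ω') : ent b p X ≤ ent b p Y := by
  rw [ent_eq_sum, ent_eq_sum, neg_le_neg_iff]
  refine Finset.sum_le_sum fun ω _ => ?_
  rcases (hp ω).eq_or_lt with h0 | h0
  · simp [← h0]
  refine mul_le_mul_of_nonneg_left (Real.logb_le_logb_of_le hb (pr_self_pos hp Y h0) ?_) (hp ω)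
  refine Finset.sum_le_sum_of_subset_of_nonneg (fun ω' => ?_) fun ω' _ _ => hp ω'
  simpa using h ω' ω

/-- Strong subadditivity of the Shannon entropy. -/
lemma ent_submodular [Fintype α] [Fintype β] [Fintype γ] (hb : 1 < b) (hp : ∀ ω, 0 ≤ p ω)
    (X : Ω → α) (Y : Ω → β) (Z : Ω → γ) :
    ent b p (fun ω => (X ω, Y ω, Z ω)) + ent b p Z
      ≤ ent b p (fun ω => (X ω, Z ω)) + ent b p (fun ω => (Y ω, Z ω)) := by
  set pXZ := pr p fun ω => (X ω, Z ω)
  set pYZ := pr p fun ω => (Y ω, Z ω)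
  set pZ := pr p Z
  set pXYZ := pr p fun ω => (X ω, Y ω, Z ω)
  have hXZ : ∀ a, 0 ≤ pXZ a := pr_nonneg hp _
  have hYZ : ∀ a, 0 ≤ pYZ a := pr_nonneg hp _
  have hZ : ∀ a, 0 ≤ pZ a := pr_nonneg hp _
  have hXYZ : ∀ a, 0 ≤ pXYZ a := pr_nonneg hp _
  let r : α × β × γ → ℝ := fun t =>
    pXZ (t.1, t.2.2) * pYZ (t.2.1, t.2.2) / (pXYZ t * pZ t.2.2)
  have hr : ∑ ω, p ω * r (X ω, Y ω, Z ω) ≤ ∑ ω, p ω := by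
    rw [← sum_pr_mul (p := p) (fun ω => (X ω, Y ω, Z ω)) r]
    calc ∑ t, pXYZ t * r t
        ≤ ∑ t : α × β × γ, pXZ (t.1, t.2.2) * pYZ (t.2.1, t.2.2) / pZ t.2.2 := by
          refine Finset.sum_le_sum fun t _ => ?_
          rcases (hXYZ t).eq_or_lt with h0 | h0
          · rw [← h0, zero_mul]
            exact div_nonneg (mul_nonneg (hXZ _) (hYZ _)) (hZ _)
          · refine le_of_eq ?_
            simp only [r]
            rw [← mul_div_assoc, mul_div_mul_left _ _ h0.ne']
      _ = ∑ z, pZ z * pZ z / pZ z := by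
          simp only [Fintype.sum_prod_type]
          rw [Finset.sum_congr rfl fun x _ => Finset.sum_comm, Finset.sum_comm]
          refine Finset.sum_congr rfl fun z _ => ?_
          simp only [← Finset.sum_div, ← Finset.mul_sum, ← Finset.sum_mul]
          rw [sum_pr_prod_left X Z z, sum_pr_prod_left Y Z z]
      _ = ∑ z, pZ z * 1 := by simp only [mul_self_div_self, mul_one]
      _ = ∑ ω, p ω := by
          rw [sum_pr_mul (p := p) Z fun _ => 1]; simp
  have hlog : 0 < Real.log b := Real.log_pos hb
  have key : ∀ ω, p ω * (Real.logb b (pXZ (X ω, Z ω)) + Real.logb b (pYZ (Y ω, Z ω))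
      - Real.logb b (pXYZ (X ω, Y ω, Z ω)) - Real.logb b (pZ (Z ω)))
      ≤ (p ω * r (X ω, Y ω, Z ω) - p ω) / Real.log b := by
    intro ω
    rcases (hp ω).eq_or_lt with h0 | h0
    · simp [← h0]
    have h1 : 0 < pXZ (X ω, Z ω) := pr_self_pos hp (fun ω => (X ω, Z ω)) h0
    have h2 : 0 < pYZ (Y ω, Z ω) := pr_self_pos hp (fun ω => (Y ω, Z ω)) h0
    have h3 : 0 < pXYZ (X ω, Y ω, Z ω) := pr_self_pos hp (fun ω => (X ω, Y ω, Z ω)) h0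
    have h4 : 0 < pZ (Z ω) := pr_self_pos hp Z h0
    have hle := Real.log_le_sub_one_of_pos (div_pos (mul_pos h1 h2) (mul_pos h3 h4))
    rw [Real.log_div (mul_pos h1 h2).ne' (mul_pos h3 h4).ne', Real.log_mul h1.ne' h2.ne',
      Real.log_mul h3.ne' h4.ne'] at hle
    simp only [Real.logb, ← add_div, ← sub_div, ← mul_div_assoc]
    refine div_le_div_of_nonneg_right ?_ hlog.le
    have := mul_le_mul_of_nonneg_left hle h0.le
    simp only [r]
    linarith
  have hsum := Finset.sum_le_sum fun ω (_ : ω ∈ Finset.univ) => key ω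
  rw [← Finset.sum_div, Finset.sum_sub_distrib] at hsum
  have hneg := hsum.trans (div_nonpos_of_nonpos_of_nonneg (sub_nonpos.2 hr) hlog.le)
  simp only [mul_sub, mul_add, Finset.sum_sub_distrib, Finset.sum_add_distrib] at hneg
  simp only [ent_eq_sum]
  linarith

/-- Conditional subadditivity of the entropy for a finite family. -/
lemma condEnt_pi_le_sum [Fintype α] [Fintype β] {ι : Type} [DecidableEq ι]
    (hb : 1 < b) (hp : ∀ ω, 0 ≤ p ω) (X : ι → Ω → α) (Y : Ω → β) (s : Finset ι) :
    condEnt b p (fun ω (i : s) => X i ω) Y ≤ ∑ i ∈ s, condEnt b p (X i) Y := by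
  induction s using Finset.induction_on with
  | empty =>
    rw [Finset.sum_empty, condEnt, sub_nonpos]
    refine (ent_congr fun ω ω' => ?_).le
    simp [funext_iff]
  | insert a s ha ih =>
    have hsub := ent_submodular hb hp (X a) (fun ω (i : s) => X i ω) Y
    have hins : ent b p (fun ω => (fun i : ↥(insert a s) => X i ω, Y ω))
        = ent b p (fun ω => (X a ω, (fun i : s => X i ω), Y ω)) := by
      refine ent_congr fun ω ω' => ?_
      simp [funext_iff, and_assoc]
    rw [Finset.sum_insert ha]
    simp only [condEnt] at ih ⊢
    linarith

lemma condEnt_pi_univ_le_sum [Fintype α] [Fintype β] {ι : Type} [Fintype ι] [DecidableEq ι]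
    (hb : 1 < b) (hp : ∀ ω, 0 ≤ p ω) (X : ι → Ω → α) (Y : Ω → β) :
    condEnt b p (fun ω i => X i ω) Y ≤ ∑ i, condEnt b p (X i) Y := by
  refine le_trans (le_of_eq ?_) (condEnt_pi_le_sum hb hp X Y Finset.univ)
  rw [condEnt, condEnt, sub_left_inj]
  refine ent_congr fun ω ω' => ?_
  simp [funext_iff]

lemma condEnt_le_condEnt_pi [Fintype α] [Fintype β] {ι : Type} [Fintype ι] [DecidableEq ι]
    (hb : 1 < b) (hp : ∀ ω, 0 ≤ p ω) (X : ι → Ω → α) (Y : Ω → β) (i : ι) :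
    condEnt b p (X i) Y ≤ condEnt b p (fun ω i => X i ω) Y := by
  refine sub_le_sub_right (ent_mono hb hp fun ω ω' h => ?_) _
  simp only [Prod.mk.injEq] at h ⊢
  exact ⟨congrFun h.1 i, h.2⟩

lemma ent_prod_of_uniform [Fintype α] [Fintype β] (hp1 : ∑ ω, p ω = 1) (hp : ∀ ω, 0 ≤ p ω)
    (X : Ω → α) (Y : Ω → β) {c : ℝ} (hc : 0 < c)
    (h : ∀ x y, pr p (fun ω => (X ω, Y ω)) (x, y) = c⁻¹ * pr p X x) :
    ent b p (fun ω => (X ω, Y ω)) = ent b p X + Real.logb b c := by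
  have hterm : ∀ ω, p ω * Real.logb b (c⁻¹ * pr p X (X ω))
      = p ω * Real.logb b (pr p X (X ω)) - p ω * Real.logb b c := by
    intro ω
    rcases (hp ω).eq_or_lt with h0 | h0
    · simp [← h0]
    rw [Real.logb_mul (inv_pos.2 hc).ne' (pr_self_pos hp X h0).ne', Real.logb_inv]
    ring
  simp only [ent_eq_sum, h, hterm, Finset.sum_sub_distrib, ← Finset.sum_mul, hp1]
  ring

end Entropy

lemma card_restrict_fiber {ι V : Type} [Fintype ι] [DecidableEq ι] [Fintype V] [DecidableEq V]
    (T : Finset ι) (v : ↥T → V) :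
    (Finset.univ.filter fun w : ι → V => (fun i : ↥T => w i) = v).card
      = Fintype.card V ^ (Fintype.card ι - T.card) := by
  have : (Finset.univ.filter fun w : ι → V => (fun i : ↥T => w i) = v)
      = Fintype.piFinset fun i => if h : i ∈ T then {v ⟨i, h⟩} else Finset.univ := by
    ext w
    simp only [Finset.mem_filter, Finset.mem_univ, true_and, Fintype.mem_piFinset, funext_iff,
      Subtype.forall]
    refine forall_congr' fun i => ?_
    by_cases h : i ∈ T <;> simp [h]
  rw [this, Fintype.card_piFinset, ← Finset.card_compl, ← Finset.prod_const,
    ← Finset.prod_subset (Finset.subset_univ Tᶜ)]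
  · refine Finset.prod_congr rfl fun i hi => ?_
    simp [Finset.mem_compl.1 hi]
  · intro i _ hi
    simp [not_not.1 (mt Finset.mem_compl.2 hi)]

/-- Uniform files, independent of the queries, contribute `L` units of entropy each. -/
lemma ent_queries_files {F R Ω : Type} [Field F] [Fintype F] [DecidableEq F] [Fintype R]
    [DecidableEq R] [Fintype Ω] {p : Ω → ℝ} (hp : ∀ ω, 0 ≤ p ω) (hp1 : ∑ ω, p ω = 1)
    {K L : ℕ} (W : Fin K → Ω → (Fin L → F)) (Q : Ω → R)
    (hUnif : ∀ (w : Fin K → Fin L → F) (q : R),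
      pr p (fun ω => ((fun i => W i ω), Q ω)) (w, q)
        = ((Fintype.card F : ℝ) ^ (K * L))⁻¹ * pr p Q q)
    (T : Finset (Fin K)) :
    ent (Fintype.card F) p (fun ω => (Q ω, (fun i : ↥T => W i ω)))
      = ent (Fintype.card F) p Q + T.card * L := by
  have hF : (1 : ℝ) < Fintype.card F := by exact_mod_cast Fintype.one_lt_card
  have hF0 : (0 : ℝ) < Fintype.card F := zero_lt_one.trans hF
  rw [ent_prod_of_uniform hp1 hp Q _ (pow_pos hF0 (T.card * L)), ← Real.rpow_natCast,
    Real.logb_rpow hF0 hF.ne']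
  · push_cast; rfl
  intro q v
  have h := pr_comp (p := p) (fun ω => ((fun i => W i ω), Q ω))
    (fun t : (Fin K → Fin L → F) × R => (t.2, (fun i : ↥T => t.1 i))) (q, v)
  have hT : T.card ≤ K := by simpa using T.card_le_univ
  rw [h, Finset.sum_filter, Fintype.sum_prod_type]
  simp only [hUnif, Prod.mk.injEq, ite_and, Finset.sum_ite_eq', Finset.mem_univ, if_true]
  rw [← Finset.sum_filter, Finset.sum_const, card_restrict_fiber, nsmul_eq_mul, ← mul_assoc]
  congr 1
  obtain ⟨k, hk⟩ := Nat.exists_eq_add_of_le hT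
  simp only [Fintype.card_fun, Fintype.card_fin]
  have hsub : K - T.card = k := by omega
  have hKL : K * L = T.card * L + L * k := (congrArg (· * L) hk).trans (by ring)
  rw [hsub, hKL]
  push_cast
  rw [pow_add, ← pow_mul]
  field_simp

/-- If the answers reveal `Z` given `Y`, their conditional entropies pay for `Z` and for the
answers given `Z`. -/
lemma ent_add_condEnt_le_sum_of_detFn {Ω α β γ ι : Type} [Fintype Ω] [Fintype ι]
    [DecidableEq ι] [Fintype α] [DecidableEq α] [Fintype β] [DecidableEq β] [Fintype γ]
    [DecidableEq γ] {p : Ω → ℝ} {b : ℝ} (hb : 1 < b) (hp : ∀ ω, 0 ≤ p ω)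
    (X : ι → Ω → α) (Y : Ω → β) (Z : Ω → γ)
    (hY : ∀ ω ω', Z ω = Z ω' → Y ω = Y ω')
    (hZ : ∀ ω ω', (∀ i, X i ω = X i ω') → Y ω = Y ω' → Z ω = Z ω') :
    ent b p Z - ent b p Y + condEnt b p (fun ω i => X i ω) Z ≤ ∑ i, condEnt b p (X i) Y := by
  refine le_trans (le_of_eq ?_) (condEnt_pi_univ_le_sum hb hp X Y)
  have : ent b p (fun ω => ((fun i => X i ω), Z ω))
      = ent b p (fun ω => ((fun i => X i ω), Y ω)) := by
    refine ent_congr fun ω ω' => ?_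
    simp only [Prod.mk.injEq]
    exact ⟨fun h => ⟨h.1, hY _ _ h.2⟩, fun h => ⟨h.1, hZ _ _ (congrFun h.1) h.2⟩⟩
  rw [condEnt, condEnt, this]
  ring

/-- The induction relation (equation (10) of the paper): if `P ≤ (K-M)/2` then
`N·H(A₁ ∣ Q, W_S) ≥ (1 + 1/N)·P·L + (1/N)·H(A₁ ∣ W_{M+1},…,W_{M+2P}, Q, W_S)`. -/
theorem induction_relation_eq10
    (F : Type) [Field F] [Fintype F] [DecidableEq F]
    (QT AT : Type) [Fintype QT] [DecidableEq QT] [Fintype AT] [DecidableEq AT]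
    (Ω : Type) [Fintype Ω]
    (p : Ω → ℝ) (hp0 : ∀ ω, 0 ≤ p ω) (hp1 : ∑ ω, p ω = 1)
    (N K L M P : ℕ) (hN : 0 < N) (hMPK : M + P ≤ K)
    (W : Fin K → Ω → (Fin L → F))
    (Qu : ↥(demands K M P) → Fin N → Ω → QT)
    (A : ↥(demands K M P) → Fin N → Ω → AT)
    (Qall : Ω → (↥(demands K M P) → Fin N → QT))
    (hQall : Qall = fun ω d n => Qu d n ω)
    (S : Finset (Fin K)) (hS : S = Finset.univ.filter (fun i => i.val < M))
    (Pd : Finset (Fin K))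
    (hPdDef : Pd = Finset.univ.filter (fun i => M ≤ i.val ∧ i.val < M + P))
    (hPd : Pd ∈ demands K M P)
    -- the files are i.i.d. uniform on `F^L` and independent of all the queries
    (hUnif : ∀ (w : Fin K → Fin L → F) (q : ↥(demands K M P) → Fin N → QT),
      pr p (fun ω => ((fun i => W i ω), Qall ω)) (w, q)
        = ((Fintype.card F : ℝ) ^ (K * L))⁻¹ * pr p Qall q)
    -- each answer is a deterministic function of the library and the received query
    (hAns : ∀ (d : ↥(demands K M P)) (n : Fin N),
      detFn (A d n) (fun ω => ((fun i => W i ω), Qu d n ω)))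
    -- decodability
    (hDec : ∀ d : ↥(demands K M P),
      detFn (fun ω => (fun i : ↥(d : Finset (Fin K)) => W i.val ω))
        (fun ω => ((fun n => A d n ω), Qall ω, (fun i : ↥S => W i.val ω))))
    -- privacy/symmetry (i)
    (hSym : ∀ (n : Fin N) (d d' : ↥(demands K M P)) (T : Finset (Fin K)),
      condEnt (Fintype.card F) p (A d n)
          (fun ω => (Qall ω, (fun i : ↥T => W i.val ω)))
        = condEnt (Fintype.card F) p (A d' ⟨0, hN⟩)
          (fun ω => (Qall ω, (fun i : ↥T => W i.val ω))))
    -- privacy/symmetry (ii)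
    (hMix : ∀ (n : Fin N) (d d' : ↥(demands K M P)),
      detFn (fun ω => (fun i : ↥(d : Finset (Fin K)) => W i.val ω))
        (fun ω => ((fun m : Fin N => if m = n then A d' n ω else A d m ω),
          Qall ω, (fun i : ↥S => W i.val ω))))
    (hReg : (P : ℝ) ≤ ((K : ℝ) - M) / 2)
    (T2 : Finset (Fin K))
    (hT2 : T2 = Finset.univ.filter (fun i => M ≤ i.val ∧ i.val < M + 2 * P)) :
    (1 + 1 / (N : ℝ)) * P * L
        + (1 / (N : ℝ)) * condEnt (Fintype.card F) p (A ⟨Pd, hPd⟩ ⟨0, hN⟩)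
            (fun ω => ((fun i : ↥T2 => W i.val ω), Qall ω, (fun i : ↥S => W i.val ω)))
      ≤ (N : ℝ) * condEnt (Fintype.card F) p (A ⟨Pd, hPd⟩ ⟨0, hN⟩)
          (fun ω => (Qall ω, (fun i : ↥S => W i.val ω))) := by
  have hb : (1 : ℝ) < Fintype.card F := by exact_mod_cast Fintype.one_lt_card
  have hN' : (0 : ℝ) < N := by exact_mod_cast hN
  have hMK : M + 2 * P ≤ K := by
    have : ((M + 2 * P : ℕ) : ℝ) ≤ K := by push_cast; linarith
    exact_mod_cast this
  let D : Finset (Fin K) := Finset.univ.filter fun i => M + P ≤ i.val ∧ i.val < M + 2 * P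
  have hDcard : D.card = P := by
    have : D.map Fin.valEmbedding = Finset.Ico (M + P) (M + 2 * P) := by
      ext i
      simp only [D, Finset.mem_map, Finset.mem_filter, Finset.mem_univ, true_and,
        Fin.valEmbedding_apply, Finset.mem_Ico]
      exact ⟨fun ⟨j, hj⟩ => by omega, fun h => ⟨⟨i, by omega⟩, h, rfl⟩⟩
    rw [← Finset.card_map Fin.valEmbedding, this, Nat.card_Ico]
    omega
  have hD : D ∈ demands K M P := by
    simp only [demands, Finset.mem_filter, Finset.mem_univ, true_and]
    exact ⟨hDcard, fun i hi => by simp only [D, Finset.mem_filter] at hi; omega⟩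
  have hstep : ∀ (T : Finset (Fin K)) (d : ↥(demands K M P)), S ⊆ T → Disjoint T d →
      P * L + condEnt (Fintype.card F) p (fun ω n => A d n ω)
          (fun ω => (Qall ω, (fun i : ↥(T ∪ d) => W i ω)))
        ≤ N * condEnt (Fintype.card F) p (A ⟨Pd, hPd⟩ ⟨0, hN⟩)
          (fun ω => (Qall ω, (fun i : ↥T => W i ω))) := by
    intro T d hST hTd
    have hdP : (d : Finset (Fin K)).card = P := (Finset.mem_filter.1 d.2).2.1
    have h := ent_add_condEnt_le_sum_of_detFn hb hp0 (A d)
      (fun ω => (Qall ω, (fun i : ↥T => W i ω)))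
      (fun ω => (Qall ω, (fun i : ↥(T ∪ d) => W i ω))) ?_ ?_
    · rw [ent_queries_files hp0 hp1 W Qall hUnif, ent_queries_files hp0 hp1 W Qall hUnif,
        Finset.card_union_of_disjoint hTd, hdP,
        Finset.sum_congr rfl fun n _ => hSym n d ⟨Pd, hPd⟩ T] at h
      simp only [Finset.sum_const, Finset.card_univ, Fintype.card_fin, nsmul_eq_mul] at h
      push_cast at h
      linarith
    · intro ω ω' h
      simp only [Prod.mk.injEq, funext_iff, Subtype.forall] at h ⊢
      exact ⟨h.1, fun i hi => h.2 i (Finset.mem_union_left _ hi)⟩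
    · intro ω ω' hA h
      have hW := (hDec d).eq_of_eq (ω := ω) (ω' := ω') (by
        simp only [Prod.mk.injEq, funext_iff, Subtype.forall] at h ⊢
        exact ⟨hA, h.1, fun i hi => h.2 i (hST hi)⟩)
      simp only [Prod.mk.injEq, funext_iff, Subtype.forall] at h hW ⊢
      refine ⟨h.1, fun i hi => ?_⟩
      rcases Finset.mem_union.1 hi with hi | hi
      · exact h.2 i hi
      · exact hW i hi
  have h₁ := hstep S ⟨Pd, hPd⟩ subset_rfl (by
    subst hS hPdDef
    refine Finset.disjoint_left.2 fun i hi hi' => ?_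
    simp only [Finset.mem_filter] at hi hi'
    omega)
  have h₂ := hstep (S ∪ Pd) ⟨D, hD⟩ Finset.subset_union_left (by
    subst hS hPdDef
    refine Finset.disjoint_left.2 fun i hi hi' => ?_
    simp only [D, Finset.mem_filter, Finset.mem_union] at hi hi'
    omega)
  have h₁' := condEnt_le_condEnt_pi hb hp0 (A ⟨Pd, hPd⟩)
    (fun ω => (Qall ω, (fun i : ↥(S ∪ Pd) => W i ω))) ⟨0, hN⟩
  have h₂' := condEnt_le_condEnt_pi hb hp0 (A ⟨D, hD⟩)
    (fun ω => (Qall ω, (fun i : ↥(S ∪ Pd ∪ D) => W i ω))) ⟨0, hN⟩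
  rw [hSym ⟨0, hN⟩ ⟨D, hD⟩ ⟨Pd, hPd⟩] at h₂'
  have hT2iff : ∀ i, i ∈ S ∪ Pd ∪ D ↔ i ∈ T2 ∨ i ∈ S := by
    intro i
    subst hS hPdDef hT2
    simp only [D, Finset.mem_filter, Finset.mem_union, Finset.mem_univ, true_and]
    omega
  have hlast : condEnt (Fintype.card F) p (A ⟨Pd, hPd⟩ ⟨0, hN⟩)
        (fun ω => ((fun i : ↥T2 => W i.val ω), Qall ω, (fun i : ↥S => W i.val ω)))
      = condEnt (Fintype.card F) p (A ⟨Pd, hPd⟩ ⟨0, hN⟩)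
        (fun ω => (Qall ω, (fun i : ↥(S ∪ Pd ∪ D) => W i ω))) := by
    refine condEnt_congr_right _ fun ω ω' => ?_
    simp only [Prod.mk.injEq, funext_iff, Subtype.forall, hT2iff, or_imp, forall_and]
    tauto
  rw [hlast]
  set u := condEnt (Fintype.card F) p (A ⟨Pd, hPd⟩ ⟨0, hN⟩)
    (fun ω => (Qall ω, (fun i : ↥(S ∪ Pd ∪ D) => W i ω)))
  have hfirst := mul_le_mul_of_nonneg_left h₁' hN'.le
  have hdiv : (1 / (N : ℝ)) * (P * L + u)
      ≤ condEnt (Fintype.card F) p (fun ω n => A ⟨Pd, hPd⟩ n ω)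
        (fun ω => (Qall ω, (fun i : ↥(S ∪ Pd) => W i ω))) := by
    rw [one_div, inv_mul_le_iff₀ hN']
    linarith
  calc _ = P * L + (1 / (N : ℝ)) * (P * L + u) := by ring
    _ ≤ _ := by linarith
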